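/- There exists a saturated 3-forest on n = 6 vertices whose number of edges is strictly less than binomial(n-1, 2) = 10; in particular the 3-graph H = (V,E) with V = {1,...,6} and E = {{1,2,3},{1,2,4},{1,2,5},{1,3,4},{2,3,6},{2,5,6},{3,4,6},{3,5,6}} is a saturated 3-forest with only 8 edges. -/

import Mathlib

/-- A surjective `t`-coloring of the vertex set `Vs` with colors `{1, ..., t}`:
the image of `Vs` under `c` is exactly `{1, ..., t}`. -/
def IsColoring (Vs : Finset ℕ) (t : ℕ) (c : ℕ → ℕ) : Prop :=
  Vs.image c = Finset.Icc 1 t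

/-- A `k`-graph `(Vs, E)` is a *`k`-forest* if for every edge `e ∈ E` there is a
surjective `k`-coloring of `Vs` under which `e` is the only rainbow edge
(an edge `f` is rainbow under `c` if `|c(f)| = k`). -/
def IsForest (Vs : Finset ℕ) (k : ℕ) (E : Finset (Finset ℕ)) : Prop :=
  ∀ e ∈ E, ∃ c : ℕ → ℕ, IsColoring Vs k c ∧
    ∀ f ∈ E, ((f.image c).card = k ↔ f = e)

/-- The vertex set `V = {1, 2, 3, 4, 5, 6}`. -/
def V6 : Finset ℕ := {1, 2, 3, 4, 5, 6}

/-- The edge set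
`E = {{1,2,3}, {1,2,4}, {1,2,5}, {1,3,4}, {2,3,6}, {2,5,6}, {3,4,6}, {3,5,6}}`. -/
def E8 : Finset (Finset ℕ) :=
  {{1, 2, 3}, {1, 2, 4}, {1, 2, 5}, {1, 3, 4}, {2, 3, 6}, {2, 5, 6}, {3, 4, 6}, {3, 5, 6}}

theorem card_image_triple (c : ℕ → ℕ) (x y z : ℕ) :
    (({x, y, z} : Finset ℕ).image c).card = 3 ↔ (c x ≠ c y ∧ c x ≠ c z ∧ c y ≠ c z) := by
  rw [Finset.image_insert, Finset.image_insert, Finset.image_singleton, Finset.card_eq_three]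
  constructor
  · rintro ⟨a, b, d, h1, h2, h3, h⟩
    have hc : ({c x, c y, c z} : Finset ℕ).card = 3 := by
      rw [h, Finset.card_eq_three]; exact ⟨a, b, d, h1, h2, h3, rfl⟩
    refine ⟨fun h => ?_, fun h => ?_, fun h => ?_⟩
    · rw [h, Finset.insert_eq_of_mem (by simp)] at hc
      have := Finset.card_le_two (a := c y) (b := c z); omega
    · rw [h, Finset.insert_eq_of_mem (by simp)] at hc
      have := Finset.card_le_two (a := c y) (b := c z); omega
    · rw [h, Finset.pair_eq_singleton] at hc
      have := Finset.card_le_two (a := c x) (b := c z); omega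
  · rintro ⟨h1, h2, h3⟩
    exact ⟨_, _, _, h1, h2, h3, rfl⟩

/-- The colouring of `{1,...,6}` with the listed colours. -/
def listColoring (l : List ℕ) (v : ℕ) : ℕ := l.getD (v - 1) 1

theorem forest_E8 : IsForest V6 3 E8 := by
  have key : ∀ e ∈ E8, ∃ l ∈ ([[1, 2, 3, 1, 2, 3], [1, 2, 1, 3, 1, 1], [1, 2, 2, 1, 3, 2],
      [1, 1, 2, 3, 1, 2], [1, 1, 2, 2, 3, 3], [1, 1, 2, 1, 3, 2], [1, 1, 1, 2, 1, 3],
      [1, 1, 2, 1, 3, 1]] : List (List ℕ)), V6.image (listColoring l) = Finset.Icc 1 3 ∧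
      ∀ f ∈ E8, ((f.image (listColoring l)).card = 3 ↔ f = e) := by
    decide +kernel
  intro e he
  obtain ⟨l, -, h⟩ := key e he
  exact ⟨listColoring l, h⟩

theorem nonedges : ∀ e ∈ Finset.powersetCard 3 V6, e ∉ E8 →
    e = {1, 2, 6} ∨ e = {3, 4, 5} ∨ e = {4, 5, 6} ∨ e = {1, 5, 6} ∨ e = {2, 3, 4} ∨
    e = {1, 3, 5} ∨ e = {1, 3, 6} ∨ e = {1, 4, 5} ∨ e = {1, 4, 6} ∨ e = {2, 3, 5} ∨
    e = {2, 4, 5} ∨ e = {2, 4, 6} := by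
  decide +kernel

/-- What a colouring isolating `e` in `E8 ∪ {{x, y, z}}` satisfies. -/
theorem isolate {e : Finset ℕ} (he : e ∈ E8) {x y z : ℕ}
    (hne : ({x, y, z} : Finset ℕ) ≠ e)
    (hf : IsForest V6 3 (insert {x, y, z} E8)) :
    ∃ c : ℕ → ℕ, (∀ v ∈ V6, c v = 1 ∨ c v = 2 ∨ c v = 3) ∧
      ¬ (c x ≠ c y ∧ c x ≠ c z ∧ c y ≠ c z) ∧
      ∀ p q r : ℕ, {p, q, r} ∈ E8 →
        ((c p ≠ c q ∧ c p ≠ c r ∧ c q ≠ c r) ↔ ({p, q, r} : Finset ℕ) = e) := by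
  obtain ⟨c, hc, h⟩ := hf e (Finset.mem_insert_of_mem he)
  refine ⟨c, fun v hv => ?_, ?_, fun p q r hp => ?_⟩
  · have : c v ∈ Finset.Icc 1 3 := by
      rw [← (hc : V6.image c = _)]; exact Finset.mem_image_of_mem c hv
    rw [Finset.mem_Icc] at this
    omega
  · rw [← card_image_triple, h _ (Finset.mem_insert_self _ _)]
    exact hne
  · rw [← card_image_triple, h _ (Finset.mem_insert_of_mem hp)]

/-- All the conditions on the six colours, for an edge `e` to be isolated. -/
theorem isolate_all {e : Finset ℕ} (he : e ∈ E8) {x y z : ℕ}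
    (hne : ({x, y, z} : Finset ℕ) ≠ e)
    (hf : IsForest V6 3 (insert {x, y, z} E8)) :
    ∃ c : ℕ → ℕ, (∀ v ∈ V6, c v = 1 ∨ c v = 2 ∨ c v = 3) ∧
      ¬ (c x ≠ c y ∧ c x ≠ c z ∧ c y ≠ c z) ∧
      ((c 1 ≠ c 2 ∧ c 1 ≠ c 3 ∧ c 2 ≠ c 3) ↔ ({1, 2, 3} : Finset ℕ) = e) ∧
      ((c 1 ≠ c 2 ∧ c 1 ≠ c 4 ∧ c 2 ≠ c 4) ↔ ({1, 2, 4} : Finset ℕ) = e) ∧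
      ((c 1 ≠ c 2 ∧ c 1 ≠ c 5 ∧ c 2 ≠ c 5) ↔ ({1, 2, 5} : Finset ℕ) = e) ∧
      ((c 1 ≠ c 3 ∧ c 1 ≠ c 4 ∧ c 3 ≠ c 4) ↔ ({1, 3, 4} : Finset ℕ) = e) ∧
      ((c 2 ≠ c 3 ∧ c 2 ≠ c 6 ∧ c 3 ≠ c 6) ↔ ({2, 3, 6} : Finset ℕ) = e) ∧
      ((c 2 ≠ c 5 ∧ c 2 ≠ c 6 ∧ c 5 ≠ c 6) ↔ ({2, 5, 6} : Finset ℕ) = e) ∧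
      ((c 3 ≠ c 4 ∧ c 3 ≠ c 6 ∧ c 4 ≠ c 6) ↔ ({3, 4, 6} : Finset ℕ) = e) ∧
      ((c 3 ≠ c 5 ∧ c 3 ≠ c 6 ∧ c 5 ≠ c 6) ↔ ({3, 5, 6} : Finset ℕ) = e) := by
  obtain ⟨c, h1, h2, h⟩ := isolate he hne hf
  exact ⟨c, h1, h2, h _ _ _ (by decide), h _ _ _ (by decide), h _ _ _ (by decide),
    h _ _ _ (by decide), h _ _ _ (by decide), h _ _ _ (by decide), h _ _ _ (by decide),
    h _ _ _ (by decide)⟩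

theorem bad123 {x y z : ℕ}
    (hx : (x, y, z) ∈ ([(1, 2, 6), (3, 4, 5), (4, 5, 6), (1, 5, 6), (2, 3, 4)] : List (ℕ × ℕ × ℕ))) :
    ¬ IsForest V6 3 (insert {x, y, z} E8) := by
  intro hf
  have hne : ({x, y, z} : Finset ℕ) ≠ {1, 2, 3} := by
    simp only [List.mem_cons, Prod.mk.injEq, List.not_mem_nil, or_false] at hx
    rcases hx with ⟨rfl, rfl, rfl⟩ | ⟨rfl, rfl, rfl⟩ | ⟨rfl, rfl, rfl⟩ | ⟨rfl, rfl, rfl⟩ |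
      ⟨rfl, rfl, rfl⟩ <;> decide
  obtain ⟨c, hv, h0, h1, h2, h3, h4, h5, h6, h7, h8⟩ := isolate_all (by decide) hne hf
  replace h1 := h1.2 rfl
  replace h2 := mt h2.1 (by decide)
  replace h3 := mt h3.1 (by decide)
  replace h4 := mt h4.1 (by decide)
  replace h5 := mt h5.1 (by decide)
  replace h6 := mt h6.1 (by decide)
  replace h7 := mt h7.1 (by decide)
  replace h8 := mt h8.1 (by decide)
  have v1 := hv 1 (by decide)
  have v2 := hv 2 (by decide)
  have v3 := hv 3 (by decide)
  have v4 := hv 4 (by decide)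
  have v5 := hv 5 (by decide)
  have v6 := hv 6 (by decide)
  clear hv hf hne
  simp only [List.mem_cons, Prod.mk.injEq, List.not_mem_nil, or_false] at hx
  rcases hx with ⟨rfl, rfl, rfl⟩ | ⟨rfl, rfl, rfl⟩ | ⟨rfl, rfl, rfl⟩ | ⟨rfl, rfl, rfl⟩ |
    ⟨rfl, rfl, rfl⟩ <;> grind

theorem bad236 {x y z : ℕ}
    (hx : (x, y, z) ∈ ([(1, 3, 5), (1, 3, 6), (1, 4, 5), (1, 4, 6), (2, 3, 5), (2, 4, 5),
      (2, 4, 6)] : List (ℕ × ℕ × ℕ))) :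
    ¬ IsForest V6 3 (insert {x, y, z} E8) := by
  intro hf
  have hne : ({x, y, z} : Finset ℕ) ≠ {2, 3, 6} := by
    simp only [List.mem_cons, Prod.mk.injEq, List.not_mem_nil, or_false] at hx
    rcases hx with ⟨rfl, rfl, rfl⟩ | ⟨rfl, rfl, rfl⟩ | ⟨rfl, rfl, rfl⟩ | ⟨rfl, rfl, rfl⟩ |
      ⟨rfl, rfl, rfl⟩ | ⟨rfl, rfl, rfl⟩ | ⟨rfl, rfl, rfl⟩ <;> decide
  obtain ⟨c, hv, h0, h1, h2, h3, h4, h5, h6, h7, h8⟩ := isolate_all (by decide) hne hf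
  replace h1 := mt h1.1 (by decide)
  replace h2 := mt h2.1 (by decide)
  replace h3 := mt h3.1 (by decide)
  replace h4 := mt h4.1 (by decide)
  replace h5 := h5.2 rfl
  replace h6 := mt h6.1 (by decide)
  replace h7 := mt h7.1 (by decide)
  replace h8 := mt h8.1 (by decide)
  have v1 := hv 1 (by decide)
  have v2 := hv 2 (by decide)
  have v3 := hv 3 (by decide)
  have v4 := hv 4 (by decide)
  have v5 := hv 5 (by decide)
  have v6 := hv 6 (by decide)
  clear hv hf hne
  simp only [List.mem_cons, Prod.mk.injEq, List.not_mem_nil, or_false] at hx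
  rcases hx with ⟨rfl, rfl, rfl⟩ | ⟨rfl, rfl, rfl⟩ | ⟨rfl, rfl, rfl⟩ | ⟨rfl, rfl, rfl⟩ |
    ⟨rfl, rfl, rfl⟩ | ⟨rfl, rfl, rfl⟩ | ⟨rfl, rfl, rfl⟩ <;> grind

/-- There is a saturated 3-forest on `n = 6` vertices with strictly fewer than
`(n-1).choose 2 = 10` edges: the 3-graph `(V6, E8)` is a saturated 3-forest with
only 8 edges. -/
theorem saturated_threeForest_with_few_edges :
    IsForest V6 3 E8 ∧
      (∀ e' ⊆ V6, e'.card = 3 → e' ∉ E8 → ¬ IsForest V6 3 (insert e' E8)) ∧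
      V6.card = 6 ∧ E8.card = 8 ∧ E8.card < Nat.choose (6 - 1) 2 := by
  refine ⟨forest_E8, fun e hs hc hn => ?_, by decide, by decide, by decide⟩
  rcases nonedges e (Finset.mem_powersetCard.2 ⟨hs, hc⟩) hn with
    rfl | rfl | rfl | rfl | rfl | rfl | rfl | rfl | rfl | rfl | rfl | rfl
  iterate 5 exact bad123 (by simp)
  iterate 7 exact bad236 (by simp)
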